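/- There exists a uniformly Σ¹₁ family (Aₙ) of subsets of ℕ, each Aₙ being either all of ℕ or a singleton, such that for every p ∈ ∏ₙAₙ there is a function g : ℕ → ℕ computable from p via a Turing functional with the property that for every Δ¹₁ function f : ℕ → ℕ one has f(n) ≤ g(n) for all but finitely many n. -/

import Mathlib

open Set

/-- Baire space. -/
abbrev Baire : Type := ℕ → ℕ

/-- The length-`n` initial segment of `x : Baire`, as a finite sequence. -/
def pre (x : Baire) (n : ℕ) : List ℕ := (List.range n).map x

/-- A Turing functional, presented by a total computable monotone map on
finite sequences. -/
structure TuringFunctional where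
  φ : List ℕ → List ℕ
  computable : Computable φ
  mono : ∀ σ τ : List ℕ, σ <+: τ → φ σ <+: φ τ

/-- `Φ` is defined on `x` with value `y`: every coordinate of `y` is eventually
output by `Φ` on initial segments of `x`. -/
def TuringFunctional.Eval (Φ : TuringFunctional) (x y : Baire) : Prop :=
  ∀ n, ∃ m, (Φ.φ (pre x m))[n]? = some (y n)

/-- Medvedev reducibility: some Turing functional is defined on every element
of `Q` and maps `Q` into `P`. -/
def MedvedevLE (P Q : Set Baire) : Prop :=
  ∃ Φ : TuringFunctional, ∀ x ∈ Q, ∃ y ∈ P, Φ.Eval x y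

/-- Strict Medvedev reducibility. -/
def MedvedevLT (P Q : Set Baire) : Prop := MedvedevLE P Q ∧ ¬ MedvedevLE Q P

/-- The homogeneous set `∏ₙ Aₙ`. -/
def homProd (A : ℕ → Set ℕ) : Set Baire := {x | ∀ n, x n ∈ A n}

/-- A family `(Aₙ)` of subsets of `ℕ` is uniformly `Σ¹₁`. -/
def UniformlySigma11 (A : ℕ → Set ℕ) : Prop :=
  ∃ R : ℕ × ℕ → List ℕ → Bool, Computable₂ R ∧
    ∀ n m : ℕ, m ∈ A n ↔ ∃ y : Baire, ∀ k, R (n, m) (pre y k) = true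

/-- A subset of Baire space is (lightface) `Σ¹₁`. -/
def Sigma11Set (S : Set Baire) : Prop :=
  ∃ R : List ℕ → List ℕ → Bool, Computable₂ R ∧
    ∀ x, x ∈ S ↔ ∃ y : Baire, ∀ m, R (pre x m) (pre y m) = true

/-- A set of finite sequences is (lightface) `Σ¹₁`. -/
def Sigma11List (T : Set (List ℕ)) : Prop :=
  ∃ R : List ℕ → List ℕ → Bool, Computable₂ R ∧
    ∀ σ, σ ∈ T ↔ ∃ y : Baire, ∀ m, R σ (pre y m) = true

/-- A tree on `ℕ`: a set of finite sequences closed under prefixes. -/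
def IsTree (T : Set (List ℕ)) : Prop := ∀ σ ∈ T, ∀ τ : List ℕ, τ <+: σ → τ ∈ T

/-- The set `[T]` of infinite paths through `T`. -/
def paths (T : Set (List ℕ)) : Set Baire := {x | ∀ n, pre x n ∈ T}

/-- A subset of `ℕ × ℕ` is (lightface) `Σ¹₁`. -/
def Sigma11Pairs (A : Set (ℕ × ℕ)) : Prop :=
  ∃ R : ℕ × ℕ → List ℕ → Bool, Computable₂ R ∧
    ∀ p : ℕ × ℕ, p ∈ A ↔ ∃ y : Baire, ∀ k, R p (pre y k) = true

/-- A function `f : ℕ → ℕ` is `Δ¹₁`: its graph is both `Σ¹₁` and `Π¹₁`. -/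
def Delta11Fun (f : ℕ → ℕ) : Prop :=
  Sigma11Pairs {p : ℕ × ℕ | f p.1 = p.2} ∧ Sigma11Pairs {p : ℕ × ℕ | f p.1 ≠ p.2}

open Encodable Denumerable

/-! ### Comparing trees by strategies -/

/-- The answers given by the strategy `h` along `σ`, the first one being given before `σ` starts. -/
def leadPlay (h : List ℕ → ℕ) (σ : List ℕ) : List ℕ :=
  (List.range (σ.length + 1)).map fun i => h (σ.take i)

theorem leadPlay_nil (h : List ℕ → ℕ) : leadPlay h [] = [h []] := rfl

theorem leadPlay_cons (h : List ℕ → ℕ) (k : ℕ) (σ : List ℕ) :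
    leadPlay h (k :: σ) = h [] :: leadPlay (fun s => h (k :: s)) σ := by
  simp only [leadPlay, List.length_cons]
  rw [List.range_succ_eq_map]
  simp [Function.comp_def]

/-- A player who moves first in `B` can shadow every position of `A`. -/
def LeadLE (A B : Set (List ℕ)) : Prop := ∃ h, ∀ σ ∈ A, leadPlay h σ ∈ B

/-- A player answering each move in `B` by a move in `A` can shadow every position of `B`. -/
def FollowLE (B A : Set (List ℕ)) : Prop := ∃ h, ∀ σ ∈ B, (leadPlay h σ).tail ∈ A

/-- The subtree of `T` above the one-element sequence `[k]`. -/
def subtreeAt (T : Set (List ℕ)) (k : ℕ) : Set (List ℕ) := {σ | k :: σ ∈ T}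

theorem IsTree.subtreeAt {T : Set (List ℕ)} (hT : IsTree T) (k : ℕ) : IsTree (subtreeAt T k) :=
  fun σ hσ τ hτ => hT (k :: σ) hσ (k :: τ) (by simpa using hτ)

theorem IsTree.nil_mem {T : Set (List ℕ)} (hT : IsTree T) {σ : List ℕ} (hσ : σ ∈ T) : [] ∈ T :=
  hT σ hσ [] List.nil_prefix

theorem FollowLE.of_subtreeAt {A B : Set (List ℕ)} (h0 : [] ∈ B → [] ∈ A)
    (h : ∀ k, ∃ j, FollowLE (subtreeAt B k) (subtreeAt A j)) : FollowLE B A := by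
  choose j f hf using h
  refine ⟨fun s => match s with
    | [] => 0
    | [k] => j k
    | k :: l :: s => f k (l :: s), ?_⟩
  rintro (_ | ⟨k, σ⟩) hσ
  · exact h0 hσ
  · have := hf k σ hσ
    rcases σ with _ | ⟨l, σ⟩
    · simpa [leadPlay_cons, leadPlay_nil, subtreeAt] using this
    · simpa [leadPlay_cons, subtreeAt] using this

theorem exists_subtreeAt_of_not_followLE {A B : Set (List ℕ)} (hA : IsTree A)
    (h : ¬ FollowLE B A) (hne : A.Nonempty) :
    ∃ k, ∀ j, ¬ FollowLE (subtreeAt B k) (subtreeAt A j) := by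
  obtain ⟨σ, hσ⟩ := hne
  by_contra! hc
  exact h (.of_subtreeAt (fun _ => hA.nil_mem hσ) hc)

open Classical in
/-- The first move of a player who avoids positions from which the opponent can follow. -/
noncomputable def escapeMove (A B : Set (List ℕ)) : ℕ :=
  if h : ∃ k, ∀ j, ¬ FollowLE (subtreeAt B k) (subtreeAt A j) then h.choose else 0

theorem not_followLE_escapeMove {A B : Set (List ℕ)} (hA : IsTree A) (h : ¬ FollowLE B A)
    (hne : A.Nonempty) (j : ℕ) : ¬ FollowLE (subtreeAt B (escapeMove A B)) (subtreeAt A j) := by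
  have hk := exists_subtreeAt_of_not_followLE hA h hne
  rw [escapeMove, dif_pos hk]
  exact hk.choose_spec j

/-- The strategy that keeps avoiding positions from which the opponent can follow. -/
noncomputable def escapeStrategy (A B : Set (List ℕ)) : List ℕ → ℕ
  | [] => escapeMove A B
  | j :: s => escapeStrategy (subtreeAt A j) (subtreeAt B (escapeMove A B)) s

theorem leadPlay_escapeStrategy_mem (σ : List ℕ) {A B : Set (List ℕ)} (hA : IsTree A)
    (hB : IsTree B) (h : ¬ FollowLE B A) (hσ : σ ∈ A) : leadPlay (escapeStrategy A B) σ ∈ B := by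
  have hmove := not_followLE_escapeMove hA h ⟨σ, hσ⟩
  induction σ generalizing A B with
  | nil =>
    rw [leadPlay_nil]
    by_contra hc
    exact hmove 0 ⟨fun _ => 0, fun τ hτ => absurd ((hB.subtreeAt _).nil_mem hτ) hc⟩
  | cons j σ ih =>
    rw [leadPlay_cons]
    exact ih (hA.subtreeAt j) (hB.subtreeAt _) (hmove j) hσ
      (not_followLE_escapeMove (hA.subtreeAt j) (hmove j) ⟨σ, hσ⟩)

/-- Determinacy of the comparison game. -/
theorem followLE_or_leadLE {A B : Set (List ℕ)} (hA : IsTree A) (hB : IsTree B) :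
    FollowLE B A ∨ LeadLE A B :=
  or_iff_not_imp_left.2 fun h =>
    ⟨escapeStrategy A B, fun σ hσ => leadPlay_escapeStrategy_mem σ hA hB h hσ⟩

theorem leadPlay_pre (h : List ℕ → ℕ) (y : Baire) (n : ℕ) :
    leadPlay h (pre y n) = pre (fun i => h (pre y i)) (n + 1) := by
  simp only [leadPlay, pre, List.length_map, List.length_range]
  refine List.map_congr_left fun i hi => ?_
  have : i ≤ n := by simpa [Nat.lt_succ_iff] using hi
  rw [← List.map_take, List.take_range, min_eq_left this]

theorem pre_tail (z : Baire) (n : ℕ) : (pre z (n + 1)).tail = pre (fun i => z (i + 1)) n := by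
  simp only [pre, List.range_succ_eq_map]
  simp [Function.comp_def]

theorem LeadLE.paths_nonempty {A B : Set (List ℕ)} (h : LeadLE A B) (hB : IsTree B)
    (hA : (paths A).Nonempty) : (paths B).Nonempty := by
  obtain ⟨f, hf⟩ := h
  obtain ⟨y, hy⟩ := hA
  refine ⟨fun i => f (pre y i), fun n => hB _ (hf _ (hy n)) _ ?_⟩
  rw [leadPlay_pre]
  simp [pre, List.range_succ]

theorem FollowLE.paths_nonempty {A B : Set (List ℕ)} (h : FollowLE B A)
    (hB : (paths B).Nonempty) : (paths A).Nonempty := by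
  obtain ⟨f, hf⟩ := h
  obtain ⟨y, hy⟩ := hB
  refine ⟨fun i => f (pre y (i + 1)), fun n => ?_⟩
  have := hf _ (hy n)
  rwa [leadPlay_pre, pre_tail] at this

/-! ### All-or-unique families from trees -/

/-- The positions of `T a` can be shadowed in `T b`, moving first unless `a < b`. Of two trees, at
least one beats the other. -/
def Beats (T : ℕ → Set (List ℕ)) (a b : ℕ) : Prop :=
  ∃ h, ∀ σ ∈ T a, (if a < b then (leadPlay h σ).tail else leadPlay h σ) ∈ T b

/-- The indices all of whose competitors are beaten: everything, if every index is beaten, and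
otherwise the unique unbeaten index. -/
def selected (T : ℕ → Set (List ℕ)) : Set ℕ := {m | ∀ b, m = b ∨ ∃ a, a ≠ b ∧ Beats T a b}

theorem beats_or_beats {T : ℕ → Set (List ℕ)} (hT : ∀ m, IsTree (T m)) {a b : ℕ} (h : a < b) :
    Beats T a b ∨ Beats T b a := by
  simpa [Beats, FollowLE, LeadLE, h, h.not_gt] using followLE_or_leadLE (hT b) (hT a)

theorem selected_eq_singleton {T : ℕ → Set (List ℕ)} (hT : ∀ m, IsTree (T m)) {b : ℕ}
    (hb : ∀ a, a ≠ b → ¬ Beats T a b) : selected T = {b} := by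
  ext m
  constructor
  · intro hm
    rcases hm b with h | ⟨a, hab, h⟩
    exacts [h, absurd h (hb a hab)]
  · rintro rfl c
    refine or_iff_not_imp_left.2 fun hc => ⟨m, hc, ?_⟩
    rcases Nat.lt_or_gt_of_ne hc with h | h
    · exact (beats_or_beats hT h).resolve_right (hb c (Ne.symm hc))
    · exact (beats_or_beats hT h).resolve_left (hb c (Ne.symm hc))

theorem selected_eq_univ_or_singleton {T : ℕ → Set (List ℕ)} (hT : ∀ m, IsTree (T m)) :
    selected T = univ ∨ ∃ m, selected T = {m} := by
  by_cases h : ∃ b, ∀ a, a ≠ b → ¬ Beats T a b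
  · exact .inr (h.imp fun b hb => selected_eq_singleton hT hb)
  · push Not at h
    exact .inl (eq_univ_of_forall fun m b => .inr (h b))

theorem selected_eq_of_paths {T : ℕ → Set (List ℕ)} (hT : ∀ m, IsTree (T m)) {b : ℕ}
    (h : ∀ a, (paths (T a)).Nonempty ↔ b ≠ a) : selected T = {b} := by
  refine selected_eq_singleton hT fun a hab hbeats => (h b).not_left.2 rfl ?_
  have ha := (h a).2 hab.symm
  by_cases hlt : a < b
  · exact FollowLE.paths_nonempty (by simpa [Beats, FollowLE, hlt] using hbeats) ha
  · exact LeadLE.paths_nonempty (by simpa [Beats, LeadLE, hlt] using hbeats) (hT b) ha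

/-! ### An enumeration of the trees of `Σ¹₁` sets -/

/-- The tree of unrefuted attempts to witness that `(n, m)` lies in the `e`-th `Σ¹₁` set, where
`N` codes the pair `(e, n)`. -/
def sigmaTree (N m : ℕ) : Set (List ℕ) :=
  {σ | ∀ k < σ.length + 1, Nat.Partrec.Code.evaln σ.length (ofNat Nat.Partrec.Code N.unpair.1)
    (encode ((N.unpair.2, m), σ.take k)) ≠ some 0}

theorem isTree_sigmaTree (N m : ℕ) : IsTree (sigmaTree N m) := by
  intro σ hσ τ hτ k hk h0
  have hle := hτ.length_le
  refine hσ k (by omega) (Nat.Partrec.Code.evaln_mono hle ?_)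
  rw [List.prefix_iff_eq_take.1 hτ, List.take_take, min_eq_left (by omega),
    List.length_take, min_eq_left hle] at h0
  exact h0

theorem pre_take (y : Baire) {k n : ℕ} (h : k ≤ n) : (pre y n).take k = pre y k := by
  rw [pre, ← List.map_take, List.take_range, min_eq_left h, pre]

theorem length_pre (y : Baire) (n : ℕ) : (pre y n).length = n := by simp [pre]

theorem mem_paths_sigmaTree {N m : ℕ} {y : Baire} :
    y ∈ paths (sigmaTree N m) ↔ ∀ k, 0 ∉ Nat.Partrec.Code.eval
      (ofNat Nat.Partrec.Code N.unpair.1) (encode ((N.unpair.2, m), pre y k)) := by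
  constructor
  · intro hy k h0
    obtain ⟨s, hs⟩ := Nat.Partrec.Code.evaln_complete.1 h0
    have := hy (max k s) k (by simp [length_pre])
    rw [length_pre, pre_take y (le_max_left _ _)] at this
    exact this (Nat.Partrec.Code.evaln_mono (le_max_right _ _) hs)
  · intro hy n k hk h0
    rw [length_pre] at hk
    rw [pre_take y (by omega)] at h0
    exact hy k (Nat.Partrec.Code.evaln_sound h0)

theorem Sigma11Pairs.exists_sigmaTree {S : Set (ℕ × ℕ)} (hS : Sigma11Pairs S) :
    ∃ e, ∀ n m, (paths (sigmaTree (Nat.pair e n) m)).Nonempty ↔ (n, m) ∈ S := by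
  obtain ⟨R, hR, hRS⟩ := hS
  obtain ⟨c, hc⟩ := Nat.Partrec.Code.exists_code.1 hR
  refine ⟨encode c, fun n m => ?_⟩
  rw [hRS]
  refine exists_congr fun y => ?_
  rw [mem_paths_sigmaTree]
  refine forall_congr' fun k => ?_
  rw [Nat.unpair_pair, ofNat_encode, hc]
  cases h : R (n, m) (pre y k) <;> simp [h]

theorem primrecPred_mem_sigmaTree :
    PrimrecPred fun x : (ℕ × ℕ) × List ℕ => x.2 ∈ sigmaTree x.1.1 x.1.2 := by
  have hev : PrimrecRel fun (k : ℕ) (x : (ℕ × ℕ) × List ℕ) =>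
      Nat.Partrec.Code.evaln x.2.length (ofNat Nat.Partrec.Code x.1.1.unpair.1)
        (encode ((x.1.1.unpair.2, x.1.2), x.2.take k)) ≠ some 0 := by
    have hN : Primrec fun z : ℕ × ((ℕ × ℕ) × List ℕ) => z.2.1.1.unpair :=
      Primrec.unpair.comp (Primrec.fst.comp (Primrec.fst.comp Primrec.snd))
    have hσ : Primrec fun z : ℕ × ((ℕ × ℕ) × List ℕ) => z.2.2 := Primrec.snd.comp Primrec.snd
    refine (Primrec.eq.comp (Nat.Partrec.Code.primrec_evaln.comp
      (((Primrec.list_length.comp hσ).pair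
        ((Primrec.ofNat _).comp (Primrec.fst.comp hN))).pair
        (Primrec.encode.comp (((Primrec.snd.comp hN).pair
          (Primrec.snd.comp (Primrec.fst.comp Primrec.snd))).pair
          (Primrec.list_take.comp Primrec.fst hσ))))) (Primrec.const (some 0))).not
  refine (hev.forall_mem_list.comp (Primrec.list_range.comp (Primrec.succ.comp
    (Primrec.list_length.comp Primrec.snd))) Primrec.id).of_eq fun x => ?_
  simp [sigmaTree]

/-! ### A normal form for `Σ¹₁` definitions -/

theorem primrec_list_sum : Primrec fun l : List ℕ => l.sum := by
  have hadd : Primrec₂ fun (_ : List ℕ) (x : ℕ × ℕ) => x.1 + x.2 :=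
    Primrec.nat_add.comp (Primrec.fst.comp Primrec.snd) (Primrec.snd.comp Primrec.snd)
  exact Primrec.list_foldr Primrec.id (Primrec.const 0) hadd

/-- A matrix quantifying over all `i` and inspecting `y` at the finitely many places `q i` defines
a `Σ¹₁` family. -/
theorem uniformlySigma11_of_queries {A : ℕ → Set ℕ} {q : ℕ → List ℕ} (hq : Primrec q)
    {Q : ((ℕ × ℕ) × ℕ) × List ℕ → Prop} (hQ : PrimrecPred Q)
    (h : ∀ n m, m ∈ A n ↔ ∃ y : Baire, ∀ i, Q (((n, m), i), (q i).map y)) :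
    UniformlySigma11 A := by
  have hi : Primrec fun x : (ℕ × ℕ) × List ℕ => x.2.length.unpair.1 :=
    Primrec.fst.comp (Primrec.unpair.comp (Primrec.list_length.comp Primrec.snd))
  have hqi : Primrec fun x : (ℕ × ℕ) × List ℕ => q x.2.length.unpair.1 := hq.comp hi
  let P (x : (ℕ × ℕ) × List ℕ) : Prop := ¬ (q x.2.length.unpair.1).sum < x.2.length ∨
    Q ((x.1, x.2.length.unpair.1), (q x.2.length.unpair.1).map fun j => x.2.getD j 0)
  have hP : PrimrecPred P := by
    refine (Primrec.nat_lt.comp (primrec_list_sum.comp hqi)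
      (Primrec.list_length.comp Primrec.snd)).not.or
      (hQ.comp ((Primrec.fst.pair hi).pair (Primrec.list_map hqi ?_)))
    exact (Primrec.list_getD 0).comp (Primrec.snd.comp Primrec.fst) Primrec.snd
  obtain ⟨_, hP⟩ := hP
  refine ⟨fun a τ => decide (P (a, τ)), hP.to_comp, fun n m => ?_⟩
  rw [h]
  refine exists_congr fun y => ?_
  have hmap : ∀ (i k : ℕ), (q i).sum < k →
      ((q i).map fun j => (pre y k).getD j 0) = (q i).map y := by
    refine fun i k hk => List.map_congr_left fun j hj => ?_
    have : j < k := (List.le_sum_of_mem hj).trans_lt hk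
    simp [pre, this]
  simp only [decide_eq_true_eq, P, length_pre]
  constructor
  · intro hy k
    refine or_iff_not_imp_left.2 fun hk => ?_
    rw [hmap _ _ (not_not.1 hk)]
    exact hy _
  · intro hy i
    have hlt : (q i).sum < Nat.pair i ((q i).sum + 1) := Nat.right_le_pair i ((q i).sum + 1)
    have := hy (Nat.pair i ((q i).sum + 1))
    rw [Nat.unpair_pair, hmap _ _ hlt] at this
    exact this.resolve_left (not_not.2 hlt)

/-- The places of a witness for `m ∈ selected T` inspected at the instance coded by `i`. -/
def selectedQueries (i : ℕ) : List ℕ :=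
  encode (i.unpair.1, (none : Option (List ℕ))) ::
    (List.range ((ofNat (List ℕ) i.unpair.2).length + 1)).map fun j =>
      encode (i.unpair.1, some ((ofNat (List ℕ) i.unpair.2).take j))

theorem primrec_selectedQueries : Primrec selectedQueries := by
  have hb : Primrec fun i : ℕ => i.unpair.1 := Primrec.fst.comp Primrec.unpair
  have hσ : Primrec fun i : ℕ => ofNat (List ℕ) i.unpair.2 :=
    (Primrec.ofNat _).comp (Primrec.snd.comp Primrec.unpair)
  refine Primrec.list_cons.comp (Primrec.encode.comp (hb.pair (Primrec.const none)))
    (Primrec.list_map (Primrec.list_range.comp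
      (Primrec.succ.comp (Primrec.list_length.comp hσ))) ?_)
  exact Primrec.encode.comp ((hb.comp Primrec.fst).pair (Primrec.option_some.comp
    (Primrec.list_take.comp Primrec.snd (hσ.comp Primrec.fst))))

theorem map_selectedQueries (y : Baire) (b : ℕ) (σ : List ℕ) :
    (selectedQueries (Nat.pair b (encode σ))).map y =
      y (encode (b, (none : Option (List ℕ)))) ::
        leadPlay (fun s => y (encode (b, some s))) σ := by
  simp [selectedQueries, leadPlay, Function.comp_def]

/-- The matrix of the `Σ¹₁` definition of `m ∈ selected T`. -/
def SelectedMatrix (x : ((ℕ × ℕ) × ℕ) × List ℕ) : Prop :=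
  x.1.1.2 = x.1.2.unpair.1 ∨ x.2.headI ≠ x.1.2.unpair.1 ∧
    (ofNat (List ℕ) x.1.2.unpair.2 ∉ sigmaTree x.1.1.1 x.2.headI ∨
      (if x.2.headI < x.1.2.unpair.1 then x.2.tail.tail else x.2.tail) ∈
        sigmaTree x.1.1.1 x.1.2.unpair.1)

theorem primrecPred_selectedMatrix : PrimrecPred SelectedMatrix := by
  have hi : Primrec fun x : ((ℕ × ℕ) × ℕ) × List ℕ => x.1.2.unpair :=
    Primrec.unpair.comp (Primrec.snd.comp Primrec.fst)
  have hb := Primrec.fst.comp hi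
  have hσ := (Primrec.ofNat (List ℕ)).comp (Primrec.snd.comp hi)
  have hN : Primrec fun x : ((ℕ × ℕ) × ℕ) × List ℕ => x.1.1 := Primrec.fst.comp Primrec.fst
  have ha : Primrec fun x : ((ℕ × ℕ) × ℕ) × List ℕ => x.2.headI :=
    Primrec.list_headI.comp Primrec.snd
  have hl : Primrec fun x : ((ℕ × ℕ) × ℕ) × List ℕ => x.2.tail :=
    Primrec.list_tail.comp Primrec.snd
  exact (Primrec.eq.comp (Primrec.snd.comp hN) hb).or ((Primrec.eq.comp ha hb).not.and
    ((primrecPred_mem_sigmaTree.comp (((Primrec.fst.comp hN).pair ha).pair hσ)).not.or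
      (primrecPred_mem_sigmaTree.comp (((Primrec.fst.comp hN).pair hb).pair
        (Primrec.ite (Primrec.nat_lt.comp ha hb) (Primrec.list_tail.comp hl) hl)))))

theorem selectedMatrix_iff (N m b : ℕ) (σ : List ℕ) (y : Baire) :
    SelectedMatrix (((N, m), Nat.pair b (encode σ)),
        (selectedQueries (Nat.pair b (encode σ))).map y) ↔
      m = b ∨ y (encode (b, (none : Option (List ℕ)))) ≠ b ∧
        (σ ∈ sigmaTree N (y (encode (b, (none : Option (List ℕ))))) →
          (if y (encode (b, (none : Option (List ℕ)))) < b then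
            (leadPlay (fun s => y (encode (b, some s))) σ).tail
          else leadPlay (fun s => y (encode (b, some s))) σ) ∈ sigmaTree N b) := by
  rw [map_selectedQueries, SelectedMatrix]
  simp only [Nat.unpair_pair, ofNat_encode, List.headI_cons, List.tail_cons, imp_iff_not_or]

theorem uniformlySigma11_selected : UniformlySigma11 fun N => selected (sigmaTree N) := by
  refine uniformlySigma11_of_queries primrec_selectedQueries primrecPred_selectedMatrix
    fun N m => ?_
  have hforall : ∀ y : Baire, (∀ i, SelectedMatrix (((N, m), i), (selectedQueries i).map y)) ↔
      ∀ b (σ : List ℕ), SelectedMatrix (((N, m), Nat.pair b (encode σ)),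
        (selectedQueries (Nat.pair b (encode σ))).map y) := by
    refine fun y => ⟨fun h b σ => h _, fun h i => ?_⟩
    simpa using h i.unpair.1 (ofNat (List ℕ) i.unpair.2)
  simp only [hforall, selectedMatrix_iff]
  constructor
  · intro hm
    choose! a h hah using fun b (hb : m ≠ b) => (hm b).resolve_left hb
    choose! f hf using hah
    refine ⟨fun i => match ofNat (ℕ × Option (List ℕ)) i with
      | (b, none) => a b
      | (b, some s) => f b s, fun b σ => or_iff_not_imp_left.2 fun hb => ?_⟩
    simp only [ofNat_encode]
    exact ⟨h b hb, hf b hb σ⟩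
  · rintro ⟨y, hy⟩ b
    refine or_iff_not_imp_left.2 fun hb => ⟨y (encode (b, (none : Option (List ℕ)))), ?_⟩
    exact ⟨((hy b []).resolve_left hb).1, fun s => y (encode (b, some s)),
      fun σ => ((hy b σ).resolve_left hb).2⟩

/-! ### The dominating function -/

/-- The functional computing the sums of the initial segments of lengths `1, 4, 9, …`. -/
def squareSums : TuringFunctional where
  φ σ := (List.range (Nat.sqrt σ.length)).map fun n => (σ.take ((n + 1) * (n + 1))).sum
  computable := by
    have hn : Primrec fun x : List ℕ × ℕ => x.2 + 1 := Primrec.succ.comp Primrec.snd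
    have htake : Primrec fun x : List ℕ × ℕ => x.1.take ((x.2 + 1) * (x.2 + 1)) :=
      Primrec.list_take.comp (Primrec.nat_mul.comp hn hn) Primrec.fst
    refine (Primrec.list_map (Primrec.list_range.comp
      (Primrec.nat_sqrt.comp Primrec.list_length)) ?_).to_comp
    exact primrec_list_sum.comp htake
  mono := by
    intro σ τ h
    have hs : Nat.sqrt σ.length ≤ Nat.sqrt τ.length := Nat.sqrt_le_sqrt h.length_le
    rw [List.prefix_iff_eq_take, List.length_map, List.length_range, ← List.map_take,
      List.take_range, min_eq_left hs]
    refine List.map_congr_left fun n hn => ?_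
    have hle : (n + 1) * (n + 1) ≤ σ.length := Nat.le_sqrt.1 (List.mem_range.1 hn)
    rw [List.prefix_iff_eq_take.1 h, List.take_take, min_eq_left hle]

theorem squareSums_eval (p : Baire) :
    squareSums.Eval p fun n => (pre p ((n + 1) * (n + 1))).sum := by
  intro n
  refine ⟨(n + 1) * (n + 1), ?_⟩
  simp [squareSums, length_pre, Nat.sqrt_eq, pre_take]

theorem le_sum_pre (p : Baire) {e n : ℕ} (h : e ≤ n) :
    p (Nat.pair e n) ≤ (pre p ((n + 1) * (n + 1))).sum := by
  refine List.le_sum_of_mem (List.mem_map_of_mem (List.mem_range.2 ?_))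
  simpa [max_eq_right h, sq] using Nat.pair_lt_max_add_one_sq e n

/-- There is an all-or-unique homogeneous `Σ¹₁` set every element of which
uniformly computes a function dominating all `Δ¹₁` functions. -/
theorem exists_aou_dominating_delta11 :
    ∃ A : ℕ → Set ℕ, UniformlySigma11 A ∧
      (∀ n, A n = Set.univ ∨ ∃ m, A n = {m}) ∧
      ∀ p ∈ homProd A, ∃ g : Baire, (∃ Φ : TuringFunctional, Φ.Eval p g) ∧
        ∀ f : ℕ → ℕ, Delta11Fun f → ∃ N, ∀ n ≥ N, f n ≤ g n := by
  refine ⟨fun N => selected (sigmaTree N), uniformlySigma11_selected,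
    fun N => selected_eq_univ_or_singleton (isTree_sigmaTree N), fun p hp =>
    ⟨_, ⟨squareSums, squareSums_eval p⟩, fun f hf => ?_⟩⟩
  obtain ⟨e, he⟩ := hf.2.exists_sigmaTree
  refine ⟨e, fun n hn => ?_⟩
  have hsel := selected_eq_of_paths (isTree_sigmaTree (Nat.pair e n))
    (b := f n) (he n)
  have hpe : p (Nat.pair e n) ∈ selected (sigmaTree (Nat.pair e n)) := hp _
  rw [hsel, mem_singleton_iff] at hpe
  exact hpe ▸ le_sum_pre p hn
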